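/- arXiv:1602.02591 — 2 statements merged into one kernel-verified Lean document; each statement's English description precedes it below -/
import Mathlib

section
/- Let Ω ⊂ ℝⁿ (n ≥ 2) be a bounded open set, let 1 < p < ∞, and let M > 0. There is a constant C = C(n, p, Ω, M) with the following property. Let σ₀, σ₁ : Ω → ℝ be measurable with 1/M ≤ σⱼ ≤ M a.e., and let A₀, A₁ : Ω → (n×n real matrices) be measurable with Aⱼ(x) symmetric and (1/M)|ξ|² ≤ Aⱼ(x)ξ·ξ ≤ M|ξ|² for a.e. x ∈ Ω and all ξ ∈ ℝⁿ. If u₀, u₁ ∈ C¹(closure Ω) are weak solutions of div(σⱼ|Aⱼ∇uⱼ·∇uⱼ|^{(p−2)/2}Aⱼ∇uⱼ) = 0 in Ω (j = 0, 1) with u₁ = u₀ on ∂Ω, then ‖∇u₁ − ∇u₀‖_{L^p(Ω)} ≤ C·(‖σ₁ − σ₀‖_{L^∞(Ω)} + ‖A₁ − A₀‖_{L^∞(Ω)})^{min{1/(p−1), 1}}·‖∇u₀‖_{L^p(Ω)}. -/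
open MeasureTheory Real
open scoped RealInnerProductSpace

/-- The linear action of an `n × n` real matrix on Euclidean space, as a
continuous linear map. -/
noncomputable def matCLM {n : ℕ} (M : Matrix (Fin n) (Fin n) ℝ) :
    EuclideanSpace ℝ (Fin n) →L[ℝ] EuclideanSpace ℝ (Fin n) :=
  LinearMap.toContinuousLinearMap (Matrix.toEuclideanLin M)

/-- `u` is a weak solution of `div(σ |A∇u·∇u|^((p-2)/2) A∇u) = 0` in `Ω`,
tested against `C¹(closure Ω)` functions vanishing on `∂Ω`. -/
def IsWeakSolution {n : ℕ} (Ω : Set (EuclideanSpace ℝ (Fin n))) (p : ℝ)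
    (σ : EuclideanSpace ℝ (Fin n) → ℝ)
    (A : EuclideanSpace ℝ (Fin n) → Matrix (Fin n) (Fin n) ℝ)
    (u : EuclideanSpace ℝ (Fin n) → ℝ) : Prop :=
  ∀ φ : EuclideanSpace ℝ (Fin n) → ℝ, ContDiffOn ℝ 1 φ (closure Ω) →
    (∀ x ∈ frontier Ω, φ x = 0) →
    ∫ x in Ω, σ x * |⟪matCLM (A x) (gradient u x), gradient u x⟫| ^ ((p - 2) / 2)
      * ⟪matCLM (A x) (gradient u x), gradient φ x⟫ = 0

/-- The `p`-Dirichlet energy `E_{σ,A}(v) = ∫_Ω σ |A∇v·∇v|^(p/2) dx`. -/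
noncomputable def energy {n : ℕ} (Ω : Set (EuclideanSpace ℝ (Fin n))) (p : ℝ)
    (σ : EuclideanSpace ℝ (Fin n) → ℝ)
    (A : EuclideanSpace ℝ (Fin n) → Matrix (Fin n) (Fin n) ℝ)
    (v : EuclideanSpace ℝ (Fin n) → ℝ) : ℝ :=
  ∫ x in Ω, σ x * |⟪matCLM (A x) (gradient v x), gradient v x⟫| ^ (p / 2)

/-- The `L^p(Ω)` norm of a vector field. -/
noncomputable def lpNormVF {n : ℕ} (Ω : Set (EuclideanSpace ℝ (Fin n))) (p : ℝ)
    (g : EuclideanSpace ℝ (Fin n) → EuclideanSpace ℝ (Fin n)) : ℝ :=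
  (∫ x in Ω, ‖g x‖ ^ p) ^ (1 / p)

/-- The `L^∞(Ω)` norm (essential supremum) of a scalar function. -/
noncomputable def linftyNorm {n : ℕ} (Ω : Set (EuclideanSpace ℝ (Fin n)))
    (f : EuclideanSpace ℝ (Fin n) → ℝ) : ℝ :=
  essSup (fun x => |f x|) (volume.restrict Ω)

/-- The `L^∞(Ω)` norm (essential supremum of the operator norm) of a
matrix-valued function. -/
noncomputable def linftyNormMat {n : ℕ} (Ω : Set (EuclideanSpace ℝ (Fin n)))
    (A : EuclideanSpace ℝ (Fin n) → Matrix (Fin n) (Fin n) ℝ) : ℝ :=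
  essSup (fun x => ‖matCLM (A x)‖) (volume.restrict Ω)

/-- A symmetric operator whose quadratic form lies between `M⁻¹ ‖ξ‖²` and `M ‖ξ‖²`. -/
def IsElliptic {E : Type*} [NormedAddCommGroup E] [InnerProductSpace ℝ E] (M : ℝ)
    (T : E →L[ℝ] E) : Prop :=
  (∀ ξ η : E, ⟪T ξ, η⟫ = ⟪ξ, T η⟫) ∧
    ∀ ξ : E, (1 / M) * ‖ξ‖ ^ 2 ≤ ⟪T ξ, ξ⟫ ∧ ⟪T ξ, ξ⟫ ≤ M * ‖ξ‖ ^ 2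

/-- The flux `σ |Tξ·ξ|^((p-2)/2) Tξ` paired with `η`. -/
noncomputable def fluxPairing {E : Type*} [NormedAddCommGroup E] [InnerProductSpace ℝ E]
    (p σ : ℝ) (T : E →L[ℝ] E) (ξ η : E) : ℝ :=
  σ * |⟪T ξ, ξ⟫| ^ ((p - 2) / 2) * ⟪T ξ, η⟫

section Pointwise

variable {E : Type*} [NormedAddCommGroup E] [InnerProductSpace ℝ E] {M : ℝ} {T : E →L[ℝ] E}

lemma IsElliptic.quad_nonneg (hM : 0 < M) (hT : IsElliptic M T) (ξ : E) : 0 ≤ ⟪T ξ, ξ⟫ :=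
  le_trans (by positivity) (hT.2 ξ).1

lemma IsElliptic.cauchy_schwarz (hM : 0 < M) (hT : IsElliptic M T) (ξ η : E) :
    ⟪T ξ, η⟫ ^ 2 ≤ ⟪T ξ, ξ⟫ * ⟪T η, η⟫ := by
  have hd : discrim ⟪T η, η⟫ (2 * ⟪T ξ, η⟫) ⟪T ξ, ξ⟫ ≤ 0 := by
    refine discrim_le_zero fun t => ?_
    have h := hT.quad_nonneg hM (ξ + t • η)
    have hs : ⟪T η, ξ⟫ = ⟪T ξ, η⟫ := by rw [hT.1, real_inner_comm]
    simp only [map_add, map_smul, inner_add_left, inner_add_right, real_inner_smul_left,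
      real_inner_smul_right, hs] at h
    linarith
  rw [discrim] at hd
  linarith

lemma IsElliptic.norm_apply_le (hM : 0 < M) (hT : IsElliptic M T) (ξ : E) :
    ‖T ξ‖ ≤ M * ‖ξ‖ := by
  rcases (norm_nonneg (T ξ)).eq_or_lt with h0 | h0
  · rw [← h0]; positivity
  have h := hT.cauchy_schwarz hM ξ (T ξ)
  rw [real_inner_self_eq_norm_sq] at h
  have h1 : ⟪T ξ, ξ⟫ * ⟪T (T ξ), T ξ⟫ ≤ (M * ‖ξ‖ ^ 2) * (M * ‖T ξ‖ ^ 2) :=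
    mul_le_mul (hT.2 ξ).2 (hT.2 _).2 (hT.quad_nonneg hM _) (by positivity)
  have h2 : ‖T ξ‖ ^ 2 * ‖T ξ‖ ^ 2 ≤ (M * ‖ξ‖) ^ 2 * ‖T ξ‖ ^ 2 := by linarith
  exact le_of_sq_le_sq (le_of_mul_le_mul_right h2 (by positivity)) (by positivity)

lemma exists_bound_lipschitz_rpow_Icc (r : ℝ) (hM : 0 < M) :
    ∃ L : ℝ, 0 < L ∧ ∀ x ∈ Set.Icc (1 / M) M, ∀ y ∈ Set.Icc (1 / M) M,
      x ^ r ≤ L ∧ |x ^ r - y ^ r| ≤ L * |x - y| := by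
  have hpos : ∀ x ∈ Set.Icc (1 / M) M, x ≠ 0 := fun x hx =>
    ((one_div_pos.2 hM).trans_le hx.1).ne'
  have hc : ∀ r : ℝ, ContinuousOn (fun x : ℝ => x ^ r) (Set.Icc (1 / M) M) := fun r =>
    continuousOn_id.rpow_const fun x hx => Or.inl (hpos x hx)
  obtain ⟨R, hR⟩ := isCompact_Icc.exists_bound_of_continuousOn (hc r)
  obtain ⟨R', hR'⟩ := isCompact_Icc.exists_bound_of_continuousOn
    (continuousOn_const.mul (hc (r - 1)) : ContinuousOn (fun x : ℝ => r * x ^ (r - 1)) _)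
  refine ⟨max 1 (max R R'), by positivity, fun x hx y hy => ⟨?_, ?_⟩⟩
  · exact (le_abs_self _).trans ((hR x hx).trans (by simp))
  · refine (convex_Icc (1 / M) M).norm_image_sub_le_of_norm_hasDerivWithin_le
      (f := fun x : ℝ => x ^ r) (f' := fun x => r * x ^ (r - 1)) (fun z hz =>
      (Real.hasDerivAt_rpow_const (Or.inl (hpos z hz))).hasDerivWithinAt)
      (fun z hz => (hR' z hz).trans (by simp)) hy hx

lemma exists_fluxPairing_perturbation_le (p : ℝ) (hM : 0 < M) :
    ∃ C : ℝ, 0 < C ∧ ∀ (D σ₀ σ₁ : ℝ) (T₀ T₁ : E →L[ℝ] E), 0 ≤ D → |σ₁ - σ₀| ≤ D →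
      ‖T₁ - T₀‖ ≤ D → (1 / M ≤ σ₁ ∧ σ₁ ≤ M) → IsElliptic M T₀ → IsElliptic M T₁ →
      ∀ a w : E, |fluxPairing p σ₀ T₀ a w - fluxPairing p σ₁ T₁ a w| ≤
        C * D * ‖a‖ ^ (p - 1) * ‖w‖ := by
  obtain ⟨L, hL, hLip⟩ := exists_bound_lipschitz_rpow_Icc ((p - 2) / 2) hM
  refine ⟨L * M + M * L * M + M * L, by positivity, ?_⟩
  intro D σ₀ σ₁ T₀ T₁ hD hσ hT hσ₁ h₀ h₁ a w
  rcases eq_or_ne a 0 with rfl | ha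
  · simp only [fluxPairing, map_zero, inner_zero_left, mul_zero, sub_zero, abs_zero]
    positivity
  have ha' : 0 < ‖a‖ := norm_pos_iff.2 ha
  have hsq : 0 < ‖a‖ ^ 2 := by positivity
  have hx : ∀ T : E →L[ℝ] E, IsElliptic M T → ⟪T a, a⟫ / ‖a‖ ^ 2 ∈ Set.Icc (1 / M) M :=
    fun T hT => ⟨(le_div_iff₀ hsq).2 (hT.2 a).1, (div_le_iff₀ hsq).2 (hT.2 a).2⟩
  have hq : ∀ T : E →L[ℝ] E, IsElliptic M T → |⟪T a, a⟫| ^ ((p - 2) / 2) =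
      (⟪T a, a⟫ / ‖a‖ ^ 2) ^ ((p - 2) / 2) * ‖a‖ ^ (p - 2) := by
    intro T hT
    have h2 : ‖a‖ ^ (p - 2) = (‖a‖ ^ 2) ^ ((p - 2) / 2) := by
      rw [← Real.rpow_natCast, ← Real.rpow_mul ha'.le]; congr 1; push_cast; ring
    rw [abs_of_nonneg (hT.quad_nonneg hM a), h2, ← Real.mul_rpow _ hsq.le,
      div_mul_cancel₀ _ hsq.ne']
    exact div_nonneg (hT.quad_nonneg hM a) hsq.le
  have hpow : ‖a‖ ^ (p - 1) = ‖a‖ ^ (p - 2) * ‖a‖ := by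
    rw [← Real.rpow_add_one ha'.ne']; congr 1; ring
  have hTd : ∀ v : E, |⟪T₀ a, v⟫ - ⟪T₁ a, v⟫| ≤ D * ‖a‖ * ‖v‖ := by
    intro v
    rw [abs_sub_comm, ← inner_sub_left, ← sub_apply]
    exact (abs_real_inner_le_norm _ _).trans (mul_le_mul_of_nonneg_right
      ((T₁ - T₀).le_of_opNorm_le hT a) (norm_nonneg _))
  have hxd : |⟪T₀ a, a⟫ / ‖a‖ ^ 2 - ⟪T₁ a, a⟫ / ‖a‖ ^ 2| ≤ D := by
    rw [← sub_div, abs_div, abs_of_pos hsq, div_le_iff₀ hsq]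
    linarith [hTd a]
  obtain ⟨hb₀, hl⟩ := hLip _ (hx T₀ h₀) _ (hx T₁ h₁)
  obtain ⟨hb₁, -⟩ := hLip _ (hx T₁ h₁) _ (hx T₁ h₁)
  have hX : |⟪T₀ a, w⟫| ≤ M * ‖a‖ * ‖w‖ :=
    (abs_real_inner_le_norm _ _).trans
      (mul_le_mul_of_nonneg_right (h₀.norm_apply_le hM a) (norm_nonneg _))
  have hn₀ := Real.rpow_nonneg ((one_div_pos.2 hM).le.trans (hx T₀ h₀).1) ((p - 2) / 2)
  have hn₁ := Real.rpow_nonneg ((one_div_pos.2 hM).le.trans (hx T₁ h₁).1) ((p - 2) / 2)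
  have hTw := hTd w
  simp only [fluxPairing, hq T₀ h₀, hq T₁ h₁, hpow]
  generalize (⟪T₀ a, a⟫ / ‖a‖ ^ 2) ^ ((p - 2) / 2) = y₀ at *
  generalize (⟪T₁ a, a⟫ / ‖a‖ ^ 2) ^ ((p - 2) / 2) = y₁ at *
  generalize ⟪T₀ a, w⟫ = X₀ at *
  generalize ⟪T₁ a, w⟫ = X₁ at *
  have hP : 0 ≤ ‖a‖ ^ (p - 2) := by positivity
  generalize ‖a‖ ^ (p - 2) = P at *
  have hl' : |y₀ - y₁| ≤ L * D := hl.trans (mul_le_mul_of_nonneg_left hxd hL.le)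
  have hσ' : |σ₀ - σ₁| ≤ D := by rwa [abs_sub_comm]
  have hσ₁' : |σ₁| ≤ M := by
    rw [abs_of_nonneg ((one_div_pos.2 hM).le.trans hσ₁.1)]; exact hσ₁.2
  have e : σ₀ * (y₀ * P) * X₀ - σ₁ * (y₁ * P) * X₁ =
      P * ((σ₀ - σ₁) * y₀ * X₀ + σ₁ * (y₀ - y₁) * X₀ + σ₁ * y₁ * (X₀ - X₁)) := by ring
  rw [e, abs_mul, abs_of_nonneg hP]
  have t1 : |(σ₀ - σ₁) * y₀ * X₀| ≤ D * L * (M * ‖a‖ * ‖w‖) := by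
    rw [abs_mul, abs_mul, abs_of_nonneg hn₀]; gcongr
  have t2 : |σ₁ * (y₀ - y₁) * X₀| ≤ M * (L * D) * (M * ‖a‖ * ‖w‖) := by
    rw [abs_mul, abs_mul]; gcongr
  have t3 : |σ₁ * y₁ * (X₀ - X₁)| ≤ M * L * (D * ‖a‖ * ‖w‖) := by
    rw [abs_mul, abs_mul, abs_of_nonneg hn₁]; gcongr
  calc P * |(σ₀ - σ₁) * y₀ * X₀ + σ₁ * (y₀ - y₁) * X₀ + σ₁ * y₁ * (X₀ - X₁)|
      ≤ P * (D * L * (M * ‖a‖ * ‖w‖) + M * (L * D) * (M * ‖a‖ * ‖w‖)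
          + M * L * (D * ‖a‖ * ‖w‖)) := by
        refine mul_le_mul_of_nonneg_left ((abs_add_three _ _ _).trans ?_) hP
        exact add_le_add_three t1 t2 t3
    _ = _ := by ring

/-- Absorption for `2 ≤ p`. -/
lemma exists_absorption_of_two_le {p c C₀ : ℝ} (hp : 2 ≤ p) (hc : 0 < c) (hC₀ : 0 < C₀) :
    ∃ C : ℝ, 0 < C ∧ ∀ D : ℝ, 0 < D → ∃ l : ℝ, ∀ s t B : ℝ, 0 ≤ s → 0 ≤ t →
      c * t ^ p - C₀ * D * s ^ (p - 1) * t ≤ B →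
        t ^ p ≤ l * B + C * D ^ (p * (1 / (p - 1))) * s ^ p := by
  have hp1 : 0 < p - 1 := by linarith
  set L : ℝ := (2 * C₀ / c) ^ (1 / (p - 1)) with hL
  have hLpos : 0 < L := by positivity
  have hLp : L ^ (p - 1) = 2 * C₀ / c := by
    rw [hL, ← Real.rpow_mul (by positivity), one_div_mul_cancel hp1.ne', Real.rpow_one]
  refine ⟨L ^ p + 2 / c * (C₀ * L), by positivity, fun D hD => ⟨2 / c, ?_⟩⟩
  intro s t B hs ht hB
  set d : ℝ := D ^ (1 / (p - 1)) with hd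
  have hdpos : 0 < d := by positivity
  have hdp : d ^ (p - 1) = D := by
    rw [hd, ← Real.rpow_mul hD.le, one_div_mul_cancel hp1.ne', Real.rpow_one]
  have hDp : D ^ (p * (1 / (p - 1))) = d ^ p := by
    rw [hd, ← Real.rpow_mul hD.le]; congr 1; ring
  have split : ∀ x : ℝ, 0 ≤ x → x ^ p = x ^ (p - 1) * x := by
    intro x hx
    rw [← Real.rpow_add_one' hx (by linarith)]; congr 1; ring
  rw [hDp]
  rcases le_total t (L * d * s) with h | h
  · have h1 : t ^ p ≤ L ^ p * d ^ p * s ^ p := by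
      rw [← Real.mul_rpow hLpos.le hdpos.le, ← Real.mul_rpow (by positivity) hs]
      exact Real.rpow_le_rpow ht h (by linarith)
    have h2 : C₀ * D * s ^ (p - 1) * t ≤ C₀ * L * (d ^ p * s ^ p) := by
      calc C₀ * D * s ^ (p - 1) * t ≤ C₀ * D * s ^ (p - 1) * (L * d * s) := by gcongr
        _ = _ := by rw [split d hdpos.le, split s hs, hdp]; ring
    have h3 : -(C₀ * L * (d ^ p * s ^ p)) ≤ B := by
      have : 0 ≤ c * t ^ p := by positivity
      linarith
    have h4 : 2 / c * (-(C₀ * L * (d ^ p * s ^ p))) ≤ 2 / c * B := by gcongr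
    linarith
  · have h1 : (L * d * s) ^ (p - 1) ≤ t ^ (p - 1) :=
      Real.rpow_le_rpow (by positivity) h hp1.le
    rw [Real.mul_rpow (by positivity) hs, Real.mul_rpow hLpos.le hdpos.le, hLp, hdp] at h1
    have h2 : C₀ * D * s ^ (p - 1) * t ≤ c / 2 * t ^ p := by
      have e : C₀ * D * s ^ (p - 1) = c / 2 * (2 * C₀ / c * D * s ^ (p - 1)) := by field_simp
      calc C₀ * D * s ^ (p - 1) * t ≤ c / 2 * t ^ (p - 1) * t := by rw [e]; gcongr
        _ = _ := by rw [split t ht]; ring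
    have h4 : 2 / c * (c / 2 * t ^ p) ≤ 2 / c * B := by gcongr; linarith
    have e : 2 / c * (c / 2 * t ^ p) = t ^ p := by field_simp
    have : 0 ≤ (L ^ p + 2 / c * (C₀ * L)) * d ^ p * s ^ p := by positivity
    linarith

/-- Absorption for `p < 2`. -/
lemma exists_absorption_of_lt_two {p c C₀ K : ℝ} (hp1 : 1 < p) (hp : p < 2) (hc : 0 < c)
    (hC₀ : 0 < C₀) (hK : 0 < K) :
    ∃ C : ℝ, 0 < C ∧ ∀ D : ℝ, 0 < D → D ≤ K → ∃ l : ℝ, ∀ s t B : ℝ, 0 ≤ s → 0 ≤ t →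
      c * ((s + t) ^ (p - 2) * t ^ 2) - C₀ * D * s ^ (p - 1) * t ≤ B →
        t ^ p ≤ l * B + C * D ^ p * s ^ p := by
  have hp1' : 0 < p - 1 := by linarith
  set Z : ℝ := 1 + 2 * C₀ * (1 + K) / c with hZ
  have hZ1 : 1 ≤ Z := by have : 0 ≤ 2 * C₀ * (1 + K) / c := by positivity
                         linarith
  set L : ℝ := Z ^ (1 / (p - 1)) with hL
  have hL1 : 1 ≤ L := Real.one_le_rpow hZ1 (by positivity)
  have hLpos : 0 < L := by linarith
  have hLp : L ^ (p - 1) = Z := by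
    rw [hL, ← Real.rpow_mul (by positivity), one_div_mul_cancel hp1'.ne', Real.rpow_one]
  -- the choice of `L` makes the perturbation term absorbable
  have hLK : C₀ * (1 + L * K) ^ (2 - p) ≤ c / 2 * L := by
    have e1 : (1 + L * K) ^ (2 - p) ≤ (1 + K) * L ^ (2 - p) := by
      calc (1 + L * K) ^ (2 - p) ≤ ((1 + K) * L) ^ (2 - p) :=
            Real.rpow_le_rpow (by positivity) (by linarith) (by linarith)
        _ = (1 + K) ^ (2 - p) * L ^ (2 - p) := Real.mul_rpow (by positivity) hLpos.le
        _ ≤ (1 + K) ^ (1 : ℝ) * L ^ (2 - p) := by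
            gcongr <;> linarith
        _ = _ := by rw [Real.rpow_one]
    have e2 : L = Z * L ^ (2 - p) := by
      rw [← hLp, ← Real.rpow_add hLpos]; ring_nf; simp
    have e3 : C₀ * (1 + K) ≤ c / 2 * Z := by
      rw [hZ]; have : c / 2 * (1 + 2 * C₀ * (1 + K) / c) = c / 2 + C₀ * (1 + K) := by
        field_simp
      linarith
    calc C₀ * (1 + L * K) ^ (2 - p) ≤ C₀ * ((1 + K) * L ^ (2 - p)) := by gcongr
      _ = C₀ * (1 + K) * L ^ (2 - p) := by ring
      _ ≤ c / 2 * Z * L ^ (2 - p) := by gcongr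
      _ = c / 2 * (Z * L ^ (2 - p)) := by ring
      _ = c / 2 * L := by rw [← e2]
  set G : ℝ := (1 + L * K) ^ (2 - p) with hG
  have hGpos : 0 < G := by positivity
  refine ⟨L ^ p + 2 / c * G * (C₀ * L), by positivity, fun D hD hDK =>
    ⟨2 / c * G * D ^ (p - 2), ?_⟩⟩
  intro s t B hs ht hB
  have split : ∀ x : ℝ, 0 ≤ x → x ^ p = x ^ (p - 1) * x := by
    intro x hx
    rw [← Real.rpow_add_one' hx (by linarith)]; congr 1; ring
  have split2 : D ^ p = D ^ (p - 2) * D ^ 2 := by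
    rw [← Real.rpow_natCast, ← Real.rpow_add hD]; congr 1; push_cast; ring
  rcases le_or_gt t (L * D * s) with h | h
  · have h1 : t ^ p ≤ L ^ p * D ^ p * s ^ p := by
      rw [← Real.mul_rpow hLpos.le hD.le, ← Real.mul_rpow (by positivity) hs]
      exact Real.rpow_le_rpow ht h (by linarith)
    have h2 : C₀ * D * s ^ (p - 1) * t ≤ C₀ * L * (D ^ 2 * s ^ p) := by
      calc C₀ * D * s ^ (p - 1) * t ≤ C₀ * D * s ^ (p - 1) * (L * D * s) := by gcongr
        _ = _ := by rw [split s hs]; ring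
    have h3 : -(C₀ * L * (D ^ 2 * s ^ p)) ≤ B := by
      have : 0 ≤ c * ((s + t) ^ (p - 2) * t ^ 2) := by positivity
      linarith
    have h4 : 2 / c * G * D ^ (p - 2) * (-(C₀ * L * (D ^ 2 * s ^ p))) ≤
        2 / c * G * D ^ (p - 2) * B := by gcongr
    have h5 : 2 / c * G * D ^ (p - 2) * (-(C₀ * L * (D ^ 2 * s ^ p))) =
        -(2 / c * G * (C₀ * L) * D ^ p * s ^ p) := by rw [split2]; ring
    linarith
  · have htpos : 0 < t := lt_of_le_of_lt (by positivity) h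
    have hst : 0 < s + t := by linarith
    have hLD : 0 < L * D := by positivity
    -- `s + t ≤ t (1 + L D) / (L D)`
    have h0 : L * D * (s + t) ≤ (1 + L * K) * t := by
      have : L * D * t ≤ L * K * t := by gcongr
      linarith
    have hm : (L * D) ^ (2 - p) * (s + t) ^ (2 - p) ≤ G * t ^ (2 - p) := by
      rw [hG, ← Real.mul_rpow hLD.le hst.le, ← Real.mul_rpow (by positivity) ht]
      exact Real.rpow_le_rpow (by positivity) h0 (by linarith)
    have hs' : (L * D) ^ (p - 1) * s ^ (p - 1) ≤ t ^ (p - 1) := by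
      rw [← Real.mul_rpow hLD.le hs]
      exact Real.rpow_le_rpow (by positivity) h.le hp1'.le
    have eLD : (L * D) ^ (2 - p) * (L * D) ^ (p - 1) = L * D := by
      rw [← Real.rpow_add hLD]; ring_nf; simp
    have et : t ^ (2 - p) * t ^ (p - 1) = t := by
      rw [← Real.rpow_add htpos]; ring_nf; simp
    have einv : (s + t) ^ (2 - p) * (s + t) ^ (p - 2) = 1 := by
      rw [← Real.rpow_add hst]; ring_nf; simp
    have hE : 0 ≤ (s + t) ^ (p - 2) := by positivity
    -- the perturbation is at most half of the coercive term
    have h1 : C₀ * D * s ^ (p - 1) * t ≤ c / 2 * ((s + t) ^ (p - 2) * t ^ 2) := by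
      have k1 : L * D * (s ^ (p - 1) * (s + t) ^ (2 - p)) ≤ G * t := by
        calc L * D * (s ^ (p - 1) * (s + t) ^ (2 - p))
            = ((L * D) ^ (2 - p) * (s + t) ^ (2 - p)) * ((L * D) ^ (p - 1) * s ^ (p - 1)) := by
              nth_rewrite 1 [← eLD]; ring
          _ ≤ (G * t ^ (2 - p)) * t ^ (p - 1) := by gcongr
          _ = G * t := by rw [mul_assoc, et]
      have k2 : C₀ * D * (s ^ (p - 1) * (s + t) ^ (2 - p)) ≤ c / 2 * t := by
        have : L * (C₀ * D * (s ^ (p - 1) * (s + t) ^ (2 - p))) ≤ L * (c / 2 * t) := by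
          calc L * (C₀ * D * (s ^ (p - 1) * (s + t) ^ (2 - p)))
              = C₀ * (L * D * (s ^ (p - 1) * (s + t) ^ (2 - p))) := by ring
            _ ≤ C₀ * (G * t) := by gcongr
            _ = C₀ * G * t := by ring
            _ ≤ c / 2 * L * t := by gcongr
            _ = _ := by ring
        exact le_of_mul_le_mul_left this hLpos
      calc C₀ * D * s ^ (p - 1) * t
          = C₀ * D * (s ^ (p - 1) * (s + t) ^ (2 - p)) * ((s + t) ^ (p - 2) * t) := by
            linear_combination (-(C₀ * D * s ^ (p - 1) * t)) * einv
        _ ≤ c / 2 * t * ((s + t) ^ (p - 2) * t) := by gcongr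
        _ = _ := by ring
    -- the coercive term controls `t ^ p`
    have h2 : t ^ p ≤ G * D ^ (p - 2) * ((s + t) ^ (p - 2) * t ^ 2) := by
      have k1 : D ^ (2 - p) * (s + t) ^ (2 - p) ≤ G * t ^ (2 - p) := by
        refine le_trans ?_ hm
        gcongr
        exact le_mul_of_one_le_left hD.le hL1
      have eD : D ^ (p - 2) * D ^ (2 - p) = 1 := by
        rw [← Real.rpow_add hD]; ring_nf; simp
      have et2 : t ^ p * t ^ (2 - p) = t ^ 2 := by
        rw [← Real.rpow_add htpos]; ring_nf; simp
      calc t ^ p = D ^ (p - 2) * ((s + t) ^ (p - 2) * t ^ p) *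
            (D ^ (2 - p) * (s + t) ^ (2 - p)) := by
            linear_combination (-(t ^ p)) * einv -
              t ^ p * ((s + t) ^ (2 - p) * (s + t) ^ (p - 2)) * eD
        _ ≤ D ^ (p - 2) * ((s + t) ^ (p - 2) * t ^ p) * (G * t ^ (2 - p)) := by gcongr
        _ = _ := by rw [← et2]; ring
    have h3 : c / 2 * ((s + t) ^ (p - 2) * t ^ 2) ≤ B := by linarith
    have h4 : 2 / c * G * D ^ (p - 2) * (c / 2 * ((s + t) ^ (p - 2) * t ^ 2)) ≤
        2 / c * G * D ^ (p - 2) * B := by gcongr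
    have e : 2 / c * G * D ^ (p - 2) * (c / 2 * ((s + t) ^ (p - 2) * t ^ 2)) =
        G * D ^ (p - 2) * ((s + t) ^ (p - 2) * t ^ 2) := by field_simp
    have : 0 ≤ (L ^ p + 2 / c * G * (C₀ * L)) * D ^ p * s ^ p := by positivity
    linarith

lemma monotone_scalar_of_two_le {p α β κ : ℝ} (hp : 2 ≤ p) (hα : 0 ≤ α) (hβ : 0 ≤ β) :
    (α ^ (p - 2) + β ^ (p - 2)) * (α ^ 2 + β ^ 2 - 2 * κ) ≤
      2 * (β ^ (p - 2) * (β ^ 2 - κ) - α ^ (p - 2) * (κ - α ^ 2)) := by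
  have key : 0 ≤ (β ^ (p - 2) - α ^ (p - 2)) * (β ^ 2 - α ^ 2) := by
    rcases le_total α β with h | h
    · exact mul_nonneg (sub_nonneg.2 (Real.rpow_le_rpow hα h (by linarith)))
        (sub_nonneg.2 (by gcongr))
    · exact mul_nonneg_of_nonpos_of_nonpos
        (sub_nonpos.2 (Real.rpow_le_rpow hβ h (by linarith))) (sub_nonpos.2 (by gcongr))
  linarith

lemma monotone_scalar_of_lt_two {p α β κ : ℝ} (hp1 : 1 < p) (hp : p < 2) (hα : 0 ≤ α)
    (hβ : 0 ≤ β) (hκ : |κ| ≤ α * β) :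
    (p - 1) * (max α β ^ (p - 2) * (α ^ 2 + β ^ 2 - 2 * κ)) ≤
      β ^ (p - 2) * (β ^ 2 - κ) - α ^ (p - 2) * (κ - α ^ 2) := by
  wlog h : α ≤ β generalizing α β
  · have := this hβ hα (by rwa [mul_comm]) (le_of_not_ge h)
    rw [max_comm]; linarith
  rw [max_eq_right h]
  rcases hα.eq_or_lt with rfl | hα'
  · have hκ0 : κ = 0 := by simpa using hκ
    subst hκ0
    have : 0 ≤ β ^ (p - 2) * β ^ 2 := by positivity
    simp only [zero_pow two_ne_zero]
    nlinarith
  have hβ' : 0 < β := hα'.trans_le h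
  have hle : β ^ (p - 2) ≤ α ^ (p - 2) :=
    Real.rpow_le_rpow_of_nonpos hα' h (by linarith)
  have hb : 0 < β ^ (p - 2) := by positivity
  -- Bernoulli's inequality for the ratio `α / β`
  have hbern : α ^ (p - 2) * α ≤ β ^ (p - 2) * (β + (p - 1) * (α - β)) := by
    have hB := rpow_one_add_le_one_add_mul_self (s := α / β - 1) (p := p - 1)
      (by have : 0 ≤ α / β := by positivity
          linarith) (by linarith) (by linarith)
    rw [add_sub_cancel, Real.div_rpow hα hβ, div_le_iff₀ (by positivity)] at hB
    have ea : α ^ (p - 1) = α ^ (p - 2) * α := by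
      rw [← Real.rpow_add_one hα'.ne']; congr 1; ring
    have eb : β ^ (p - 1) = β ^ (p - 2) * β := by
      rw [← Real.rpow_add_one hβ'.ne']; congr 1; ring
    rw [ea, eb] at hB
    refine hB.trans_eq ?_
    field_simp
  have hk : 0 ≤ α * β - κ := by linarith [le_abs_self κ]
  have h1 : 0 ≤ (α ^ (p - 2) + β ^ (p - 2) - 2 * (p - 1) * β ^ (p - 2)) * (α * β - κ) := by
    refine mul_nonneg ?_ hk
    nlinarith
  have h2 : 0 ≤ (β - α) * (β ^ (p - 2) * (β + (p - 1) * (α - β)) - α ^ (p - 2) * α) :=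
    mul_nonneg (by linarith) (by linarith)
  linarith

lemma fluxPairing_sub_eq (hM : 0 < M) (hT : IsElliptic M T) (p σ : ℝ) (a b : E) :
    fluxPairing p σ T b (b - a) - fluxPairing p σ T a (b - a) =
      σ * (√⟪T b, b⟫ ^ (p - 2) * (√⟪T b, b⟫ ^ 2 - ⟪T a, b⟫) -
        √⟪T a, a⟫ ^ (p - 2) * (⟪T a, b⟫ - √⟪T a, a⟫ ^ 2)) := by
  have hs : ⟪T b, a⟫ = ⟪T a, b⟫ := by rw [hT.1, real_inner_comm]
  have hN : ∀ ξ : E, |⟪T ξ, ξ⟫| ^ ((p - 2) / 2) = √⟪T ξ, ξ⟫ ^ (p - 2) := by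
    intro ξ
    rw [abs_of_nonneg (hT.quad_nonneg hM ξ), Real.sqrt_eq_rpow,
      ← Real.rpow_mul (hT.quad_nonneg hM ξ)]
    congr 1; ring
  simp only [fluxPairing, hN, inner_sub_right, hs, Real.sq_sqrt (hT.quad_nonneg hM _)]
  ring

lemma IsElliptic.abs_inner_le (hM : 0 < M) (hT : IsElliptic M T) (a b : E) :
    |⟪T a, b⟫| ≤ √⟪T a, a⟫ * √⟪T b, b⟫ := by
  rw [← Real.sqrt_mul (hT.quad_nonneg hM a)]
  exact Real.abs_le_sqrt (hT.cauchy_schwarz hM a b)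

lemma IsElliptic.norm_sub_sq_le (hM : 0 < M) (hT : IsElliptic M T) (a b : E) :
    ‖b - a‖ ^ 2 ≤ M * (√⟪T a, a⟫ ^ 2 + √⟪T b, b⟫ ^ 2 - 2 * ⟪T a, b⟫) := by
  have h := (hT.2 (b - a)).1
  have hs : ⟪T b, a⟫ = ⟪T a, b⟫ := by rw [hT.1, real_inner_comm]
  rw [one_div, inv_mul_le_iff₀ hM] at h
  refine h.trans_eq ?_
  simp only [map_sub, inner_sub_left, inner_sub_right, hs,
    Real.sq_sqrt (hT.quad_nonneg hM _)]
  ring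

lemma IsElliptic.sqrt_quad_le (hT : IsElliptic M T) (a : E) :
    √⟪T a, a⟫ ≤ √M * ‖a‖ := by
  rw [← Real.sqrt_sq (norm_nonneg a), ← Real.sqrt_mul' _ (sq_nonneg _)]
  exact Real.sqrt_le_sqrt (hT.2 a).2

lemma exists_coercive_of_two_le {p : ℝ} (hp : 2 ≤ p) (hM : 0 < M) :
    ∃ c : ℝ, 0 < c ∧ ∀ (σ : ℝ) (T : E →L[ℝ] E), 1 / M ≤ σ → IsElliptic M T → ∀ a b : E,
      c * ‖b - a‖ ^ p ≤ fluxPairing p σ T b (b - a) - fluxPairing p σ T a (b - a) := by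
  set R : ℝ := (√M * 2) ^ (p - 2) with hR
  have hRpos : 0 < R := by positivity
  refine ⟨1 / M * (1 / (2 * R * M)), by positivity, fun σ T hσ hT a b => ?_⟩
  rw [fluxPairing_sub_eq hM hT]
  have hκ := hT.abs_inner_le hM a b
  have hw := hT.norm_sub_sq_le hM a b
  set α := √⟪T a, a⟫
  set β := √⟪T b, b⟫
  set κ := ⟪T a, b⟫
  have hα : 0 ≤ α := Real.sqrt_nonneg _
  have hβ : 0 ≤ β := Real.sqrt_nonneg _
  have hmono := monotone_scalar_of_two_le (κ := κ) hp hα hβ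
  set W := α ^ 2 + β ^ 2 - 2 * κ with hWdef
  have hMW : 0 ≤ M * W := (sq_nonneg _).trans hw
  have hW : W ≤ (α + β) ^ 2 := by
    nlinarith [neg_abs_le κ]
  have ht : ‖b - a‖ ≤ √M * 2 * max α β := by
    refine le_of_sq_le_sq (hw.trans ?_) (by positivity)
    have h2 : α + β ≤ 2 * max α β := by linarith [le_max_left α β, le_max_right α β]
    calc M * W ≤ M * (2 * max α β) ^ 2 := by gcongr; exact hW.trans (by gcongr)
      _ = _ := by rw [mul_assoc, mul_pow (√M), Real.sq_sqrt hM.le]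
  have hpow : ‖b - a‖ ^ (p - 2) ≤ R * (α ^ (p - 2) + β ^ (p - 2)) := by
    calc ‖b - a‖ ^ (p - 2) ≤ (√M * 2 * max α β) ^ (p - 2) :=
          Real.rpow_le_rpow (norm_nonneg _) ht (by linarith)
      _ = R * max α β ^ (p - 2) := Real.mul_rpow (by positivity) (by positivity)
      _ ≤ _ := by
        gcongr
        rcases max_cases α β with h | h <;> rw [h.1]
        · exact le_add_of_nonneg_right (by positivity)
        · exact le_add_of_nonneg_left (by positivity)
  have hsplit : ‖b - a‖ ^ p = ‖b - a‖ ^ (p - 2) * ‖b - a‖ ^ 2 := by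
    rw [← Real.rpow_natCast, ← Real.rpow_add_of_nonneg (norm_nonneg _) (by linarith) (by simp)]
    congr 1; push_cast; ring
  have hfin : ‖b - a‖ ^ p ≤ 2 * R * M * (β ^ (p - 2) * (β ^ 2 - κ) - α ^ (p - 2) * (κ - α ^ 2)) := by
    calc ‖b - a‖ ^ p ≤ R * (α ^ (p - 2) + β ^ (p - 2)) * (M * W) := by
          rw [hsplit]; gcongr
      _ = R * M * ((α ^ (p - 2) + β ^ (p - 2)) * W) := by ring
      _ ≤ R * M * (2 * (β ^ (p - 2) * (β ^ 2 - κ) - α ^ (p - 2) * (κ - α ^ 2))) := by gcongr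
      _ = _ := by ring
  have hfin' : 1 / (2 * R * M) * ‖b - a‖ ^ p ≤
      β ^ (p - 2) * (β ^ 2 - κ) - α ^ (p - 2) * (κ - α ^ 2) := by
    rw [one_div, inv_mul_le_iff₀ (by positivity)]; exact hfin
  rw [mul_assoc]
  exact mul_le_mul hσ hfin' (by positivity) ((one_div_pos.2 hM).le.trans hσ)

lemma exists_coercive_of_lt_two {p : ℝ} (hp1 : 1 < p) (hp : p < 2) (hM : 0 < M) :
    ∃ c : ℝ, 0 < c ∧ ∀ (σ : ℝ) (T : E →L[ℝ] E), 1 / M ≤ σ → IsElliptic M T → ∀ a b : E,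
      c * ((‖a‖ + ‖b - a‖) ^ (p - 2) * ‖b - a‖ ^ 2) ≤
        fluxPairing p σ T b (b - a) - fluxPairing p σ T a (b - a) := by
  have hp1' : 0 < p - 1 := by linarith
  refine ⟨1 / M * ((p - 1) * √M ^ (p - 2) * (1 / M)), by positivity, fun σ T hσ hT a b => ?_⟩
  rw [fluxPairing_sub_eq hM hT]
  have hκ := hT.abs_inner_le hM a b
  have hw := hT.norm_sub_sq_le hM a b
  have hαle := hT.sqrt_quad_le a
  have hβle := hT.sqrt_quad_le b
  have hab : ‖b‖ ≤ ‖a‖ + ‖b - a‖ := by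
    simpa using norm_add_le a (b - a)
  set α := √⟪T a, a⟫
  set β := √⟪T b, b⟫
  set κ := ⟪T a, b⟫
  have hα : 0 ≤ α := Real.sqrt_nonneg _
  have hβ : 0 ≤ β := Real.sqrt_nonneg _
  have hmono := monotone_scalar_of_lt_two hp1 hp hα hβ hκ
  set W := α ^ 2 + β ^ 2 - 2 * κ with hWdef
  set t := ‖b - a‖
  set s := ‖a‖
  have hs : 0 ≤ s := norm_nonneg _
  have ht : 0 ≤ t := norm_nonneg _
  have hmax : max α β ≤ √M * (s + t) := by
    refine max_le (hαle.trans ?_) (hβle.trans ?_) <;> gcongr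
    linarith
  have hWt : 1 / M * t ^ 2 ≤ W := by
    rw [one_div, inv_mul_le_iff₀ hM]; exact hw
  have hcore : √M ^ (p - 2) * (s + t) ^ (p - 2) * (1 / M * t ^ 2) ≤ max α β ^ (p - 2) * W := by
    rcases (le_max_of_le_left hα : 0 ≤ max α β).eq_or_lt with h0 | h0
    · have hα0 : α = 0 := le_antisymm (h0 ▸ le_max_left α β) hα
      have hβ0 : β = 0 := le_antisymm (h0 ▸ le_max_right α β) hβ
      have hκ0 : κ = 0 := by rw [hα0, zero_mul] at hκ; exact abs_nonpos_iff.1 hκ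
      have hW0 : W = 0 := by rw [hWdef, hα0, hβ0, hκ0]; ring
      have ht0 : t ^ 2 = 0 := le_antisymm (by rw [hW0, mul_zero] at hw; exact hw) (sq_nonneg _)
      rw [ht0, hW0]; simp
    · have hpow : √M ^ (p - 2) * (s + t) ^ (p - 2) ≤ max α β ^ (p - 2) := by
        rw [← Real.mul_rpow (by positivity) (by positivity)]
        exact Real.rpow_le_rpow_of_nonpos h0 hmax (by linarith)
      exact mul_le_mul hpow hWt (by positivity) (by positivity)
  have hfin : (p - 1) * √M ^ (p - 2) * (1 / M) * ((s + t) ^ (p - 2) * t ^ 2) ≤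
      β ^ (p - 2) * (β ^ 2 - κ) - α ^ (p - 2) * (κ - α ^ 2) := by
    refine le_trans ?_ hmono
    calc _ = (p - 1) * (√M ^ (p - 2) * (s + t) ^ (p - 2) * (1 / M * t ^ 2)) := by ring
      _ ≤ _ := by gcongr
  rw [mul_assoc]
  exact mul_le_mul hσ hfin (by positivity) ((one_div_pos.2 hM).le.trans hσ)

lemma exists_pointwise_stability {p K : ℝ} (hp1 : 1 < p) (hM : 0 < M) (hK : 0 < K) :
    ∃ C : ℝ, 0 < C ∧ ∀ D : ℝ, 0 < D → D ≤ K → ∃ l : ℝ,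
      ∀ (σ₀ σ₁ : ℝ) (T₀ T₁ : E →L[ℝ] E), |σ₁ - σ₀| ≤ D → ‖T₁ - T₀‖ ≤ D →
      (1 / M ≤ σ₁ ∧ σ₁ ≤ M) → IsElliptic M T₀ → IsElliptic M T₁ → ∀ a b : E,
        ‖b - a‖ ^ p ≤ l * (fluxPairing p σ₁ T₁ b (b - a) - fluxPairing p σ₀ T₀ a (b - a)) +
          C * D ^ (p * min (1 / (p - 1)) 1) * ‖a‖ ^ p := by
  obtain ⟨C₀, hC₀, hpert⟩ := exists_fluxPairing_perturbation_le (E := E) p hM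
  have hp1' : 0 < p - 1 := by linarith
  rcases le_or_gt 2 p with hp | hp
  · rw [min_eq_left (by rw [div_le_one hp1']; linarith)]
    obtain ⟨c, hc, hcoer⟩ := exists_coercive_of_two_le (E := E) hp hM
    obtain ⟨C, hC, habs⟩ := exists_absorption_of_two_le hp hc hC₀
    refine ⟨C, hC, fun D hD _ => (habs D hD).imp fun l hl => ?_⟩
    intro σ₀ σ₁ T₀ T₁ hσ hT hσ₁ h₀ h₁ a b
    refine hl _ _ _ (norm_nonneg _) (norm_nonneg _) ?_
    have e1 := hcoer σ₁ T₁ hσ₁.1 h₁ a b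
    have e2 := le_of_abs_le (hpert D σ₀ σ₁ T₀ T₁ hD.le hσ hT hσ₁ h₀ h₁ a (b - a))
    linarith
  · rw [min_eq_right (by rw [le_div_iff₀ hp1']; linarith), mul_one]
    obtain ⟨c, hc, hcoer⟩ := exists_coercive_of_lt_two (E := E) hp1 hp hM
    obtain ⟨C, hC, habs⟩ := exists_absorption_of_lt_two hp1 hp hc hC₀ hK
    refine ⟨C, hC, fun D hD hDK => (habs D hD hDK).imp fun l hl => ?_⟩
    intro σ₀ σ₁ T₀ T₁ hσ hT hσ₁ h₀ h₁ a b
    refine hl _ _ _ (norm_nonneg _) (norm_nonneg _) ?_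
    have e1 := hcoer σ₁ T₁ hσ₁.1 h₁ a b
    have e2 := le_of_abs_le (hpert D σ₀ σ₁ T₀ T₁ hD.le hσ hT hσ₁ h₀ h₁ a (b - a))
    linarith

end Pointwise

lemma abs_fluxPairing_le {E : Type*} [NormedAddCommGroup E] [InnerProductSpace ℝ E]
    {p M σ : ℝ} {T : E →L[ℝ] E} (hp1 : 1 < p) (hM : 0 < M) (hσ : 1 / M ≤ σ ∧ σ ≤ M)
    (hT : IsElliptic M T) (ξ η : E) :
    |fluxPairing p σ T ξ η| ≤ M * ((√M * ‖ξ‖) ^ (p - 1) * (√M * ‖η‖)) := by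
  have hσ0 : 0 ≤ σ := (one_div_pos.2 hM).le.trans hσ.1
  have hN : |⟪T ξ, ξ⟫| ^ ((p - 2) / 2) = √⟪T ξ, ξ⟫ ^ (p - 2) := by
    rw [abs_of_nonneg (hT.quad_nonneg hM ξ), Real.sqrt_eq_rpow,
      ← Real.rpow_mul (hT.quad_nonneg hM ξ)]
    congr 1; ring
  have hpow : √⟪T ξ, ξ⟫ ^ (p - 2) * √⟪T ξ, ξ⟫ = √⟪T ξ, ξ⟫ ^ (p - 1) := by
    rw [← Real.rpow_add_one' (Real.sqrt_nonneg _) (by linarith)]; congr 1; ring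
  rw [fluxPairing, hN, abs_mul, abs_mul, abs_of_nonneg hσ0, abs_of_nonneg (by positivity),
    mul_assoc]
  calc σ * (√⟪T ξ, ξ⟫ ^ (p - 2) * |⟪T ξ, η⟫|)
      ≤ M * (√⟪T ξ, ξ⟫ ^ (p - 2) * (√⟪T ξ, ξ⟫ * √⟪T η, η⟫)) := by
        gcongr
        · exact hσ.2
        · exact hT.abs_inner_le hM ξ η
    _ = M * (√⟪T ξ, ξ⟫ ^ (p - 1) * √⟪T η, η⟫) := by rw [← mul_assoc (_ ^ _), hpow]
    _ ≤ _ := by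
        gcongr
        · exact hT.sqrt_quad_le ξ
        · exact hT.sqrt_quad_le η

section Euclidean

variable {n : ℕ}

lemma isElliptic_matCLM {M : ℝ} {A : Matrix (Fin n) (Fin n) ℝ}
    (hA : A.IsSymm ∧ ∀ ξ : EuclideanSpace ℝ (Fin n),
      (1 / M) * ‖ξ‖ ^ 2 ≤ ⟪matCLM A ξ, ξ⟫ ∧ ⟪matCLM A ξ, ξ⟫ ≤ M * ‖ξ‖ ^ 2) :
    IsElliptic M (matCLM A) := by
  refine ⟨fun ξ η => ?_, hA.2⟩
  have h : A.IsHermitian := by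
    rw [Matrix.IsHermitian, Matrix.conjTranspose_eq_transpose_of_trivial]; exact hA.1
  exact Matrix.isSymmetric_toEuclideanLin_iff.2 h ξ η

lemma matCLM_sub (A B : Matrix (Fin n) (Fin n) ℝ) : matCLM (A - B) = matCLM A - matCLM B := by
  simp [matCLM]

lemma inner_matCLM (A : Matrix (Fin n) (Fin n) ℝ) (ξ η : EuclideanSpace ℝ (Fin n)) :
    ⟪matCLM A ξ, η⟫ = ∑ i, (∑ j, A i j * ξ j) * η i := by
  simp [matCLM, PiLp.inner_apply, Matrix.mulVec, dotProduct, mul_comm]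

lemma aemeasurable_inner_matCLM {μ : Measure (EuclideanSpace ℝ (Fin n))}
    {A : EuclideanSpace ℝ (Fin n) → Matrix (Fin n) (Fin n) ℝ}
    {f g : EuclideanSpace ℝ (Fin n) → EuclideanSpace ℝ (Fin n)}
    (hA : ∀ i j : Fin n, Measurable fun x => A x i j) (hf : AEMeasurable f μ)
    (hg : AEMeasurable g μ) : AEMeasurable (fun x => ⟪matCLM (A x) (f x), g x⟫) μ := by
  have hcoord : ∀ {h : EuclideanSpace ℝ (Fin n) → EuclideanSpace ℝ (Fin n)} (i : Fin n),
      AEMeasurable h μ → AEMeasurable (fun x => h x i) μ := fun i hh =>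
    (EuclideanSpace.proj (𝕜 := ℝ) i).continuous.measurable.comp_aemeasurable hh
  simp only [inner_matCLM]
  refine Finset.aemeasurable_fun_sum _ fun i _ => ?_
  exact (Finset.aemeasurable_fun_sum _ fun j _ =>
    ((hA i j).aemeasurable.mul (hcoord j hf))).mul (hcoord i hg)

lemma integrableOn_fluxPairing {Ω : Set (EuclideanSpace ℝ (Fin n))} (hΩ : volume Ω < ⊤)
    {p M : ℝ} (hp1 : 1 < p) (hM : 0 < M) {σ : EuclideanSpace ℝ (Fin n) → ℝ}
    {A : EuclideanSpace ℝ (Fin n) → Matrix (Fin n) (Fin n) ℝ}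
    {f g : EuclideanSpace ℝ (Fin n) → EuclideanSpace ℝ (Fin n)}
    (hσm : Measurable σ) (hAm : ∀ i j : Fin n, Measurable fun x => A x i j)
    (hσ : ∀ᵐ x ∂(volume.restrict Ω), 1 / M ≤ σ x ∧ σ x ≤ M)
    (hA : ∀ᵐ x ∂(volume.restrict Ω), IsElliptic M (matCLM (A x)))
    (hf : AEMeasurable f (volume.restrict Ω)) (hg : AEMeasurable g (volume.restrict Ω))
    {a b : ℝ} (hfb : ∀ᵐ x ∂(volume.restrict Ω), ‖f x‖ ≤ a)
    (hgb : ∀ᵐ x ∂(volume.restrict Ω), ‖g x‖ ≤ b) :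
    IntegrableOn (fun x => fluxPairing p (σ x) (matCLM (A x)) (f x) (g x)) Ω := by
  have hm : AEMeasurable (fun x => fluxPairing p (σ x) (matCLM (A x)) (f x) (g x))
      (volume.restrict Ω) := by
    unfold fluxPairing
    refine (hσm.aemeasurable.mul ?_).mul (aemeasurable_inner_matCLM hAm hf hg)
    exact (continuous_abs.measurable.comp_aemeasurable
      (aemeasurable_inner_matCLM hAm hf hf)).pow_const _
  refine IntegrableOn.of_bound hΩ hm.aestronglyMeasurable
    (M * ((√M * a) ^ (p - 1) * (√M * b))) ?_
  filter_upwards [hσ, hA, hfb, hgb] with x h1 h2 h3 h4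
  refine (abs_fluxPairing_le hp1 hM h1 h2 _ _).trans ?_
  have : 0 ≤ a := (norm_nonneg _).trans h3
  gcongr

lemma integrableOn_norm_rpow {Ω : Set (EuclideanSpace ℝ (Fin n))} (hΩ : volume Ω < ⊤)
    {p : ℝ} (hp : 0 ≤ p) {f : EuclideanSpace ℝ (Fin n) → EuclideanSpace ℝ (Fin n)}
    (hf : AEMeasurable f (volume.restrict Ω)) {a : ℝ}
    (hfb : ∀ᵐ x ∂(volume.restrict Ω), ‖f x‖ ≤ a) :
    IntegrableOn (fun x => ‖f x‖ ^ p) Ω := by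
  refine IntegrableOn.of_bound hΩ (hf.norm.pow_const p).aestronglyMeasurable (a ^ p) ?_
  filter_upwards [hfb] with x hx
  rw [Real.norm_of_nonneg (by positivity)]
  gcongr

variable {Ω : Set (EuclideanSpace ℝ (Fin n))} {u v : EuclideanSpace ℝ (Fin n) → ℝ}

lemma continuousOn_gradient (hΩ : IsOpen Ω) (hu : ContDiffOn ℝ 1 u (closure Ω)) :
    ContinuousOn (gradient u) Ω :=
  (InnerProductSpace.toDual ℝ _).symm.continuous.comp_continuousOn
    ((hu.mono subset_closure).continuousOn_fderiv_of_isOpen hΩ le_rfl)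

lemma exists_norm_gradient_le (hΩ : IsOpen Ω) (hΩb : Bornology.IsBounded Ω)
    (hu : ContDiffOn ℝ 1 u (closure Ω)) : ∃ B : ℝ, ∀ x ∈ Ω, ‖gradient u x‖ ≤ B := by
  have key : ∃ B : ℝ, ∀ x ∈ closure Ω ∩ Ω, ‖gradient u x‖ ≤ B := by
    refine hΩb.isCompact_closure.induction_on
      (p := fun S => ∃ B : ℝ, ∀ x ∈ S ∩ Ω, ‖gradient u x‖ ≤ B) ⟨0, by simp⟩ ?_ ?_ ?_
    · rintro s t hst ⟨B, hB⟩
      exact ⟨B, fun x hx => hB x ⟨hst hx.1, hx.2⟩⟩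
    · rintro s t ⟨B, hB⟩ ⟨B', hB'⟩
      refine ⟨max B B', ?_⟩
      rintro x ⟨hx | hx, hxΩ⟩
      · exact (hB x ⟨hx, hxΩ⟩).trans (le_max_left _ _)
      · exact (hB' x ⟨hx, hxΩ⟩).trans (le_max_right _ _)
    · intro x hx
      have h := hu x hx
      rw [← zero_add (1 : WithTop ℕ∞),
        contDiffWithinAt_succ_iff_hasFDerivWithinAt' (by simp)] at h
      obtain ⟨U, hU, -, -, f', hf', hc⟩ := h
      rw [Set.insert_eq_of_mem hx] at hU
      have hb : ∀ᶠ y in nhdsWithin x (closure Ω), ‖f' y‖ < ‖f' x‖ + 1 :=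
        hc.continuousWithinAt.norm.eventually (gt_mem_nhds (lt_add_one _))
      refine ⟨_, Filter.inter_mem hU hb, ‖f' x‖ + 1, ?_⟩
      rintro y ⟨⟨hyU, hyb⟩, hyΩ⟩
      have hd : HasFDerivAt u (f' y) y := (hf' y hyU).hasFDerivAt
        (Filter.mem_of_superset (hΩ.mem_nhds hyΩ) subset_closure)
      rw [gradient, LinearIsometryEquiv.norm_map, hd.fderiv]
      exact le_of_lt hyb
  obtain ⟨B, hB⟩ := key
  exact ⟨B, fun x hx => hB x ⟨subset_closure hx, hx⟩⟩

lemma gradient_sub_of_mem (hΩ : IsOpen Ω) (hu : ContDiffOn ℝ 1 u (closure Ω))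
    (hv : ContDiffOn ℝ 1 v (closure Ω)) {x : EuclideanSpace ℝ (Fin n)} (hx : x ∈ Ω) :
    gradient (fun y => v y - u y) x = gradient v x - gradient u x := by
  have hd : ∀ {w : EuclideanSpace ℝ (Fin n) → ℝ}, ContDiffOn ℝ 1 w (closure Ω) →
      DifferentiableAt ℝ w x := fun hw =>
    (hw.contDiffAt (Filter.mem_of_superset (hΩ.mem_nhds hx) subset_closure)).differentiableAt
      one_ne_zero
  rw [gradient, fderiv_fun_sub (hd hv) (hd hu), map_sub]; rfl

end Euclidean

lemma essSup_bounds {α : Type*} [MeasurableSpace α] {μ : Measure α} [NeZero μ] {f : α → ℝ}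
    {K : ℝ} (h0 : ∀ x, 0 ≤ f x) (hK : ∀ᵐ x ∂μ, f x ≤ K) :
    (∀ᵐ x ∂μ, f x ≤ essSup f μ) ∧ 0 ≤ essSup f μ ∧ essSup f μ ≤ K := by
  have hae : ∀ᵐ x ∂μ, f x ≤ essSup f μ := ae_le_essSup ⟨K, hK⟩
  obtain ⟨x, hx⟩ := hae.exists
  refine ⟨hae, (h0 x).trans hx, ?_⟩
  refine Filter.limsup_le_of_le ?_ hK
  exact Filter.IsCoboundedUnder.of_frequently_ge (a := 0) (Filter.Frequently.of_forall h0)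

/-- **Lemma 3.2**: stability of the gradient in `L^p` under perturbation of the
coefficients: `‖∇u₁ − ∇u₀‖_{L^p} ≤ C (‖σ₁ − σ₀‖_∞ + ‖A₁ − A₀‖_∞)^{min(1/(p−1),1)} ‖∇u₀‖_{L^p}`. -/
theorem gradient_lp_stability
    {n : ℕ} (hn : 2 ≤ n) (Ω : Set (EuclideanSpace ℝ (Fin n)))
    (hΩopen : IsOpen Ω) (hΩbdd : Bornology.IsBounded Ω)
    (p : ℝ) (hp1 : 1 < p) (M : ℝ) (hM : 0 < M) :
    ∃ C : ℝ, 0 < C ∧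
      ∀ (σ₀ σ₁ : EuclideanSpace ℝ (Fin n) → ℝ)
        (A₀ A₁ : EuclideanSpace ℝ (Fin n) → Matrix (Fin n) (Fin n) ℝ),
        Measurable σ₀ → Measurable σ₁ →
        (∀ i j : Fin n, Measurable fun x => A₀ x i j) →
        (∀ i j : Fin n, Measurable fun x => A₁ x i j) →
        (∀ᵐ x ∂(volume.restrict Ω), 1 / M ≤ σ₀ x ∧ σ₀ x ≤ M) →
        (∀ᵐ x ∂(volume.restrict Ω), 1 / M ≤ σ₁ x ∧ σ₁ x ≤ M) →
        (∀ᵐ x ∂(volume.restrict Ω), (A₀ x).IsSymm ∧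
          ∀ ξ : EuclideanSpace ℝ (Fin n),
            (1 / M) * ‖ξ‖ ^ 2 ≤ ⟪matCLM (A₀ x) ξ, ξ⟫ ∧
            ⟪matCLM (A₀ x) ξ, ξ⟫ ≤ M * ‖ξ‖ ^ 2) →
        (∀ᵐ x ∂(volume.restrict Ω), (A₁ x).IsSymm ∧
          ∀ ξ : EuclideanSpace ℝ (Fin n),
            (1 / M) * ‖ξ‖ ^ 2 ≤ ⟪matCLM (A₁ x) ξ, ξ⟫ ∧
            ⟪matCLM (A₁ x) ξ, ξ⟫ ≤ M * ‖ξ‖ ^ 2) →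
        ∀ u₀ u₁ : EuclideanSpace ℝ (Fin n) → ℝ,
          ContDiffOn ℝ 1 u₀ (closure Ω) → ContDiffOn ℝ 1 u₁ (closure Ω) →
          IsWeakSolution Ω p σ₀ A₀ u₀ → IsWeakSolution Ω p σ₁ A₁ u₁ →
          (∀ x ∈ frontier Ω, u₁ x = u₀ x) →
          lpNormVF Ω p (fun x => gradient u₁ x - gradient u₀ x) ≤
            C * (linftyNorm Ω (fun x => σ₁ x - σ₀ x)
                  + linftyNormMat Ω (fun x => A₁ x - A₀ x)) ^ min (1 / (p - 1)) 1
              * lpNormVF Ω p (fun x => gradient u₀ x) := by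
  have hp0 : 0 < p := by linarith
  obtain ⟨C, hC, hpt⟩ := exists_pointwise_stability (E := EuclideanSpace ℝ (Fin n))
    (K := 4 * M + 1) hp1 hM (by positivity)
  refine ⟨C ^ (1 / p), by positivity, ?_⟩
  intro σ₀ σ₁ A₀ A₁ hσ₀m hσ₁m hA₀m hA₁m hσ₀ hσ₁ hA₀ hA₁ u₀ u₁ hu₀ hu₁ hw₀ hw₁ hbd
  rcases eq_or_ne (volume.restrict Ω) 0 with hμ | hμ
  · simp only [lpNormVF, hμ, integral_zero_measure]
    rw [Real.zero_rpow (by positivity), mul_zero]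
  have : NeZero (volume.restrict Ω) := ⟨hμ⟩
  have hE₀ := hA₀.mono fun x hx => isElliptic_matCLM hx
  have hE₁ := hA₁.mono fun x hx => isElliptic_matCLM hx
  obtain ⟨hsae, hs0, hsK⟩ := essSup_bounds (μ := volume.restrict Ω) (K := 2 * M)
    (f := fun x => |σ₁ x - σ₀ x|) (fun x => abs_nonneg _) (by
      filter_upwards [hσ₀, hσ₁] with x h0 h1
      have := one_div_pos.2 hM
      rw [abs_le]; constructor <;> linarith)
  obtain ⟨haae, ha0, haK⟩ := essSup_bounds (μ := volume.restrict Ω) (K := 2 * M)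
    (f := fun x => ‖matCLM (A₁ x - A₀ x)‖) (fun x => norm_nonneg _) (by
      filter_upwards [hE₀, hE₁] with x h0 h1
      rw [matCLM_sub]
      have e0 := (matCLM (A₀ x)).opNorm_le_bound hM.le (h0.norm_apply_le hM)
      have e1 := (matCLM (A₁ x)).opNorm_le_bound hM.le (h1.norm_apply_le hM)
      linarith [norm_sub_le (matCLM (A₁ x)) (matCLM (A₀ x))])
  change 0 ≤ linftyNorm Ω (fun x => σ₁ x - σ₀ x) at hs0
  change 0 ≤ linftyNormMat Ω (fun x => A₁ x - A₀ x) at ha0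
  change linftyNorm Ω (fun x => σ₁ x - σ₀ x) ≤ _ at hsK
  change linftyNormMat Ω (fun x => A₁ x - A₀ x) ≤ _ at haK
  change ∀ᵐ x ∂(volume.restrict Ω), _ ≤ linftyNorm Ω (fun x => σ₁ x - σ₀ x) at hsae
  change ∀ᵐ x ∂(volume.restrict Ω), _ ≤ linftyNormMat Ω (fun x => A₁ x - A₀ x) at haae
  generalize linftyNorm Ω (fun x => σ₁ x - σ₀ x) = δs at *
  generalize linftyNormMat Ω (fun x => A₁ x - A₀ x) = δa at *
  have hvol : volume Ω < ⊤ := hΩbdd.measure_lt_top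
  have hmeas : ∀ {u : EuclideanSpace ℝ (Fin n) → ℝ}, ContDiffOn ℝ 1 u (closure Ω) →
      AEMeasurable (gradient u) (volume.restrict Ω) := fun hu =>
    (continuousOn_gradient hΩopen hu).aemeasurable hΩopen.measurableSet
  obtain ⟨B₀, hB₀⟩ := exists_norm_gradient_le hΩopen hΩbdd hu₀
  obtain ⟨B₁, hB₁⟩ := exists_norm_gradient_le hΩopen hΩbdd hu₁
  have hae : ∀ᵐ x ∂(volume.restrict Ω), x ∈ Ω := ae_restrict_mem hΩopen.measurableSet
  have hb₀ : ∀ᵐ x ∂(volume.restrict Ω), ‖gradient u₀ x‖ ≤ B₀ := hae.mono hB₀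
  have hb₁ : ∀ᵐ x ∂(volume.restrict Ω), ‖gradient u₁ x‖ ≤ B₁ := hae.mono hB₁
  have hbw : ∀ᵐ x ∂(volume.restrict Ω), ‖gradient u₁ x - gradient u₀ x‖ ≤ B₁ + B₀ := by
    filter_upwards [hb₀, hb₁] with x h0 h1
    exact (norm_sub_le _ _).trans (add_le_add h1 h0)
  have hmw : AEMeasurable (fun x => gradient u₁ x - gradient u₀ x) (volume.restrict Ω) :=
    (hmeas hu₁).sub (hmeas hu₀)
  have hi₀ := integrableOn_fluxPairing hvol hp1 hM hσ₀m hA₀m hσ₀ hE₀ (hmeas hu₀) hmw hb₀ hbw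
  have hi₁ := integrableOn_fluxPairing hvol hp1 hM hσ₁m hA₁m hσ₁ hE₁ (hmeas hu₁) hmw hb₁ hbw
  have hisub : IntegrableOn (fun x =>
      fluxPairing p (σ₁ x) (matCLM (A₁ x)) (gradient u₁ x) (gradient u₁ x - gradient u₀ x) -
        fluxPairing p (σ₀ x) (matCLM (A₀ x)) (gradient u₀ x)
          (gradient u₁ x - gradient u₀ x)) Ω := hi₁.sub hi₀
  have hiw := integrableOn_norm_rpow hvol hp0.le hmw hbw
  have hia := integrableOn_norm_rpow hvol hp0.le (hmeas hu₀) hb₀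
  have hz : ∀ {σ : EuclideanSpace ℝ (Fin n) → ℝ}
      {A : EuclideanSpace ℝ (Fin n) → Matrix (Fin n) (Fin n) ℝ}
      {u : EuclideanSpace ℝ (Fin n) → ℝ}, IsWeakSolution Ω p σ A u →
      ∫ x in Ω, fluxPairing p (σ x) (matCLM (A x)) (gradient u x)
        (gradient u₁ x - gradient u₀ x) = 0 := by
    intro σ A u hu
    rw [← hu (fun x => u₁ x - u₀ x) (hu₁.sub hu₀) fun x hx => sub_eq_zero.2 (hbd x hx)]
    refine setIntegral_congr_fun hΩopen.measurableSet fun x hx => ?_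
    simp only [fluxPairing, gradient_sub_of_mem hΩopen hu₀ hu₁ hx]
  set m : ℝ := min (1 / (p - 1)) 1 with hm
  have hm0 : 0 ≤ m := le_min (one_div_nonneg.2 (by linarith)) zero_le_one
  have hmain : ∀ D ∈ Set.Ioc (δs + δa) (δs + δa + 1),
      lpNormVF Ω p (fun x => gradient u₁ x - gradient u₀ x) ≤
        C ^ (1 / p) * D ^ m * lpNormVF Ω p (fun x => gradient u₀ x) := by
    intro D hD
    have hD0 : 0 < D := lt_of_le_of_lt (by positivity) hD.1
    obtain ⟨l, hl⟩ := hpt D hD0 (by linarith [hD.2])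
    have hint : ∫ x in Ω, ‖gradient u₁ x - gradient u₀ x‖ ^ p ≤
        C * D ^ (p * m) * ∫ x in Ω, ‖gradient u₀ x‖ ^ p := by
      calc ∫ x in Ω, ‖gradient u₁ x - gradient u₀ x‖ ^ p
          ≤ ∫ x in Ω, (l * (fluxPairing p (σ₁ x) (matCLM (A₁ x)) (gradient u₁ x)
                (gradient u₁ x - gradient u₀ x) -
              fluxPairing p (σ₀ x) (matCLM (A₀ x)) (gradient u₀ x)
                (gradient u₁ x - gradient u₀ x)) +
              C * D ^ (p * m) * ‖gradient u₀ x‖ ^ p) := by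
            refine integral_mono_ae hiw ((hisub.const_mul l).add (hia.const_mul _)) ?_
            filter_upwards [hsae, haae, hσ₁, hE₀, hE₁] with x h1 h2 h3 h4 h5
            refine hl _ _ _ _ (by linarith [hD.1]) ?_ h3 h4 h5 _ _
            rw [← matCLM_sub]; linarith [hD.1]
        _ = _ := by
            rw [integral_add (hisub.const_mul l) (hia.const_mul _),
              integral_const_mul, integral_const_mul, integral_sub hi₁ hi₀, hz hw₀, hz hw₁]
            simp
    have hI : 0 ≤ ∫ x in Ω, ‖gradient u₀ x‖ ^ p :=
      integral_nonneg fun x => by positivity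
    calc lpNormVF Ω p (fun x => gradient u₁ x - gradient u₀ x)
        ≤ (C * D ^ (p * m) * ∫ x in Ω, ‖gradient u₀ x‖ ^ p) ^ (1 / p) :=
          Real.rpow_le_rpow (integral_nonneg fun x => by positivity) hint (by positivity)
      _ = _ := by
          rw [Real.mul_rpow (by positivity) hI, Real.mul_rpow hC.le (by positivity),
            ← Real.rpow_mul hD0.le, lpNormVF]
          congr 3
          field_simp
  have hcont : Continuous fun D : ℝ =>
      C ^ (1 / p) * D ^ m * lpNormVF Ω p (fun x => gradient u₀ x) :=
    (continuous_const.mul (Real.continuous_rpow_const hm0)).mul continuous_const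
  exact ge_of_tendsto (hcont.continuousWithinAt (s := Set.Ioi (δs + δa))).tendsto
    (Filter.mem_of_superset (Ioc_mem_nhdsGT (lt_add_one _)) hmain)
end

section
/- Let Ω ⊂ ℝⁿ (n ≥ 2) be a bounded open set satisfying the interior measure density condition, let 0 < β < 1, let 1 < p < ∞, and let θ satisfy (n/p)/(β + n/p) < θ ≤ 1. Then there is a constant C > 0 (depending on n, p, β, θ, Ω) such that for all M₀, M₁ > 0 and every function f : closure(Ω) → ℝ satisfying ‖f‖_{L^p(Ω)} ≤ M₀ and ‖f‖_{C^β(closure Ω)} ≤ M₁, one has sup_{x ∈ Ω} |f(x)| ≤ C·M₀^{1−θ}·M₁^{θ}. -/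
open MeasureTheory Real

/-- `Ω` satisfies the interior measure density condition: there is `c > 0`
with `|B(x,r) ∩ Ω| ≥ c rⁿ` for all `x ∈ Ω` and `0 < r ≤ diam Ω`. -/
def MeasureDensityCondition {n : ℕ} (Ω : Set (EuclideanSpace ℝ (Fin n))) : Prop :=
  ∃ c : ℝ, 0 < c ∧ ∀ x ∈ Ω, ∀ r : ℝ, 0 < r → r ≤ Metric.diam Ω →
    ENNReal.ofReal (c * r ^ n) ≤ volume (Metric.ball x r ∩ Ω)

/-- A function that is Hölder continuous on a set is continuous there. -/
lemma continuousOn_of_abs_sub_le_mul_rpow {E : Type*} [SeminormedAddCommGroup E] {s : Set E}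
    {f : E → ℝ} {M β : ℝ} (hβ : 0 < β)
    (hf : ∀ x ∈ s, ∀ y ∈ s, |f x - f y| ≤ M * ‖x - y‖ ^ β) : ContinuousOn f s := by
  intro x hx
  have hlim : Filter.Tendsto (fun y => M * ‖y - x‖ ^ β) (nhdsWithin x s) (nhds 0) := by
    have hcont : Continuous fun y : E => M * ‖y - x‖ ^ β :=
      continuous_const.mul
        ((continuous_id.sub continuous_const).norm.rpow_const fun _ => Or.inr hβ.le)
    have := hcont.tendsto x
    simp only [sub_self, norm_zero, Real.zero_rpow hβ.ne', mul_zero] at this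
    exact this.mono_left nhdsWithin_le_nhds
  refine tendsto_iff_dist_tendsto_zero.2
    (squeeze_zero' (Filter.Eventually.of_forall fun _ => dist_nonneg) ?_ hlim)
  filter_upwards [self_mem_nhdsWithin] with y hy
  rw [Real.dist_eq]
  exact hf y hy x hx

/-- A bounded function that is continuous on a measurable set of finite measure has an integrable
`p`-th power there. -/
lemma integrableOn_abs_rpow_of_bounded {E : Type*} [TopologicalSpace E] [MeasurableSpace E]
    [OpensMeasurableSpace E] {μ : Measure E} {s : Set E} (hs : MeasurableSet s) (hμ : μ s ≠ ⊤)
    {f : E → ℝ} {M p : ℝ} (hp : 0 ≤ p) (hf : ContinuousOn f s) (hM : ∀ x ∈ s, |f x| ≤ M) :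
    IntegrableOn (fun x => |f x| ^ p) s μ := by
  refine IntegrableOn.of_bound hμ.lt_top ?_ (M ^ p) ?_
  · exact (hf.abs.rpow_const fun _ _ => Or.inr hp).aestronglyMeasurable hs
  · refine (ae_restrict_iff' hs).2 (Filter.Eventually.of_forall fun x hx => ?_)
    rw [Real.norm_of_nonneg (by positivity)]
    exact Real.rpow_le_rpow (abs_nonneg _) (hM x hx) hp

/-- Chebyshev's inequality on a subset where `|f|` is bounded below. -/
lemma rpow_mul_le_setIntegral_abs_rpow {E : Type*} [MeasurableSpace E] {μ : Measure E}
    {s t : Set E} (ht : MeasurableSet t) (hts : t ⊆ s) (hμ : μ s ≠ ⊤)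
    {f : E → ℝ} {b m p : ℝ} (hp : 0 ≤ p) (hb : 0 ≤ b)
    (hint : IntegrableOn (fun x => |f x| ^ p) s μ) (hbf : ∀ x ∈ t, b ≤ |f x|)
    (hm : ENNReal.ofReal m ≤ μ t) :
    b ^ p * m ≤ ∫ x in s, |f x| ^ p ∂μ := by
  have htop : μ t ≠ ⊤ := measure_ne_top_of_subset hts hμ
  calc b ^ p * m ≤ b ^ p * μ.real t := by
        gcongr
        exact (ENNReal.ofReal_le_iff_le_toReal htop).1 hm
    _ ≤ ∫ x in t, |f x| ^ p ∂μ :=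
        setIntegral_ge_of_const_le_real ht htop
          (fun x hx => Real.rpow_le_rpow hb (hbf x hx) hp) (hint.mono_set hts)
    _ ≤ ∫ x in s, |f x| ^ p ∂μ :=
        setIntegral_mono_set hint (Filter.Eventually.of_forall fun x => by positivity)
          (LE.le.eventuallyLE hts)

/-- On a ball of radius `κ (|f x| / M) ^ (1 / β)` with `κ ≤ 2 ^ (-1 / β)`, a `β`-Hölder function
keeps at least half of its size at the centre. -/
lemma half_abs_le_of_holder {E : Type*} [SeminormedAddCommGroup E] {f : E → ℝ} {x y : E}
    {M β κ : ℝ} (hβ : 0 < β) (hM : 0 < M) (hκ2 : κ ≤ (1 / 2 : ℝ) ^ (1 / β))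
    (hf : |f x - f y| ≤ M * ‖x - y‖ ^ β)
    (hxy : ‖x - y‖ ≤ κ * (|f x| / M) ^ (1 / β)) : |f x| / 2 ≤ |f y| := by
  have hpow : ‖x - y‖ ^ β ≤ 1 / 2 * (|f x| / M) := by
    calc ‖x - y‖ ^ β ≤ ((1 / 2 : ℝ) ^ (1 / β) * (|f x| / M) ^ (1 / β)) ^ β := by
          gcongr
          exact hxy.trans (by gcongr)
      _ = 1 / 2 * (|f x| / M) := by
          rw [← Real.mul_rpow (by positivity) (by positivity), ← Real.rpow_mul (by positivity),
            one_div_mul_cancel hβ.ne', Real.rpow_one]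
  have hdiff : |f x - f y| ≤ |f x| / 2 := by
    calc |f x - f y| ≤ M * (1 / 2 * (|f x| / M)) := hf.trans (by gcongr)
      _ = |f x| / 2 := by field_simp
  linarith [abs_sub_abs_le_abs_sub (f x) (f y)]

/-- If `t ≤ 1` and `t ^ q ≤ K s ^ p`, then `t ≤ K ^ ((1 - θ) / p) s ^ (1 - θ)` as soon as
`q (1 - θ) ≤ p`. -/
lemma le_rpow_mul_rpow_of_rpow_le {t s K p q θ : ℝ} (ht : 0 < t) (ht1 : t ≤ 1) (hs : 0 < s)
    (hK : 0 < K) (hp : 0 < p) (hθ : θ ≤ 1) (hq : q * (1 - θ) ≤ p)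
    (h : t ^ q ≤ K * s ^ p) : t ≤ K ^ ((1 - θ) / p) * s ^ (1 - θ) := by
  have hμ : 0 ≤ (1 - θ) / p := div_nonneg (by linarith) hp.le
  calc t = t ^ (1 : ℝ) := (Real.rpow_one t).symm
    _ ≤ t ^ (q * ((1 - θ) / p)) := by
        refine Real.rpow_le_rpow_of_exponent_ge ht ht1 ?_
        rw [← mul_div_assoc]
        exact (div_le_one hp).2 hq
    _ = (t ^ q) ^ ((1 - θ) / p) := Real.rpow_mul ht.le _ _
    _ ≤ (K * s ^ p) ^ ((1 - θ) / p) := by gcongr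
    _ = K ^ ((1 - θ) / p) * s ^ (1 - θ) := by
        rw [Real.mul_rpow hK.le (by positivity), ← Real.rpow_mul hs.le, mul_div_cancel₀ _ hp.ne']

/-- The lower bound on the interpolation exponent, with denominators cleared. -/
lemma add_div_mul_one_sub_le {N p β θ : ℝ} (hN : 0 ≤ N) (hp : 0 < p) (hβ : 0 < β)
    (hθ : (N / p) / (β + N / p) < θ) : (p + N / β) * (1 - θ) ≤ p := by
  have hpos : 0 < β + N / p := by positivity
  rw [div_lt_iff₀ hpos] at hθ
  have h : (p + N / β) * (1 - θ) = p / β * ((β + N / p) * (1 - θ)) := by field_simp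
  calc (p + N / β) * (1 - θ) = p / β * ((β + N / p) * (1 - θ)) := h
    _ ≤ p / β * β := by gcongr; linarith
    _ = p := div_mul_cancel₀ _ hβ.ne'

/-- **Lemma A.2 (interpolation)**: for `θ ∈ ((n/p)/(β + n/p), 1]` there is
`C > 0` so that `‖f‖_{L^∞(Ω)} ≤ C M₀^{1−θ} M₁^θ` whenever `‖f‖_{L^p(Ω)} ≤ M₀`
and `‖f‖_{C^β(closure Ω)} ≤ M₁` (the Hölder bound split into a sup bound and a
Hölder seminorm bound by `M₁`). -/
theorem interpolation_lp_holder
    {n : ℕ} (hn : 2 ≤ n) (Ω : Set (EuclideanSpace ℝ (Fin n)))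
    (hΩopen : IsOpen Ω) (hΩbdd : Bornology.IsBounded Ω)
    (hΩdens : MeasureDensityCondition Ω)
    (β : ℝ) (hβ0 : 0 < β) (hβ1 : β < 1)
    (p : ℝ) (hp1 : 1 < p)
    (θ : ℝ) (hθ1 : (n / p) / (β + n / p) < θ) (hθ2 : θ ≤ 1) :
    ∃ C : ℝ, 0 < C ∧
      ∀ M₀ M₁ : ℝ, 0 < M₀ → 0 < M₁ →
      ∀ f : EuclideanSpace ℝ (Fin n) → ℝ,
        (∫ x in Ω, |f x| ^ p) ^ (1 / p) ≤ M₀ →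
        (∀ x ∈ closure Ω, |f x| ≤ M₁) →
        (∀ x ∈ closure Ω, ∀ y ∈ closure Ω, |f x - f y| ≤ M₁ * ‖x - y‖ ^ β) →
        ∀ x ∈ Ω, |f x| ≤ C * M₀ ^ (1 - θ) * M₁ ^ θ := by
  obtain ⟨c, hc, hdens⟩ := hΩdens
  have hp0 : 0 < p := by linarith
  rcases Ω.eq_empty_or_nonempty with rfl | ⟨x₀, hx₀⟩
  · exact ⟨1, one_pos, fun _ _ _ _ _ _ _ _ x hx => hx.elim⟩
  have : Nonempty (Fin n) := ⟨⟨0, by omega⟩⟩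
  have hD : 0 < Metric.diam Ω := by
    have := Module.punctured_nhds_neBot ℝ (EuclideanSpace ℝ (Fin n)) x₀
    exact Metric.diam_pos (infinite_of_mem_nhds x₀ (hΩopen.mem_nhds hx₀)).nontrivial hΩbdd
  have hfin : volume Ω ≠ ⊤ := hΩbdd.measure_lt_top.ne
  set κ : ℝ := min (Metric.diam Ω) ((1 / 2 : ℝ) ^ (1 / β))
  have hκ0 : 0 < κ := lt_min hD (by positivity)
  have hK : 0 < 2 ^ p / (c * κ ^ n) := by positivity
  refine ⟨(2 ^ p / (c * κ ^ n)) ^ ((1 - θ) / p), by positivity, ?_⟩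
  intro M₀ M₁ hM₀ hM₁ f hLp hsup hhol x hx
  rcases (abs_nonneg (f x)).eq_or_lt with hfx | hfx
  · rw [← hfx]
    positivity
  have hsub : Ω ⊆ closure Ω := subset_closure
  set t := |f x| / M₁ with ht
  have ht0 : 0 < t := by positivity
  have ht1 : t ≤ 1 := (div_le_one hM₁).2 (hsup x (hsub hx))
  have htβ : t ^ (1 / β) ≤ 1 := Real.rpow_le_one ht0.le ht1 (by positivity)
  set r := κ * t ^ (1 / β) with hr
  have hr0 : 0 < r := by positivity
  have hrD : r ≤ Metric.diam Ω :=
    (mul_le_of_le_one_right hκ0.le htβ).trans (min_le_left _ _)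
  have hint : IntegrableOn (fun y => |f y| ^ p) Ω :=
    integrableOn_abs_rpow_of_bounded hΩopen.measurableSet hfin hp0.le
      ((continuousOn_of_abs_sub_le_mul_rpow hβ0 hhol).mono hsub) fun y hy => hsup y (hsub hy)
  have hmass : (|f x| / 2) ^ p * (c * r ^ n) ≤ ∫ y in Ω, |f y| ^ p := by
    refine rpow_mul_le_setIntegral_abs_rpow (measurableSet_ball.inter hΩopen.measurableSet)
      Set.inter_subset_right hfin hp0.le (by positivity) hint ?_ (hdens x hx r hr0 hrD)
    rintro y ⟨hyx, hy⟩
    refine half_abs_le_of_holder (κ := κ) hβ0 hM₁ (min_le_right _ _)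
      (hhol x (hsub hx) y (hsub hy)) ?_
    rw [← dist_eq_norm, dist_comm]
    exact (Metric.mem_ball.1 hyx).le
  have hI : ∫ y in Ω, |f y| ^ p ≤ M₀ ^ p := by
    have hI0 : 0 ≤ ∫ y in Ω, |f y| ^ p := integral_nonneg fun y => by positivity
    rwa [one_div, Real.rpow_inv_le_iff_of_pos hI0 hM₀.le hp0] at hLp
  have hrn : r ^ n = κ ^ n * t ^ (n / β) := by
    rw [hr, mul_pow, ← Real.rpow_mul_natCast ht0.le, one_div_mul_eq_div]
  have hfxt : |f x| = M₁ * t := by rw [ht]; field_simp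
  have hkey : t ^ (p + n / β) ≤ 2 ^ p / (c * κ ^ n) * (M₀ / M₁) ^ p := by
    have h := hmass.trans hI
    rw [hrn, hfxt, Real.div_rpow (by positivity) zero_le_two, Real.mul_rpow hM₁.le ht0.le] at h
    rw [Real.rpow_add ht0, Real.div_rpow hM₀.le hM₁.le, div_mul_div_comm,
      le_div_iff₀ (by positivity)]
    calc t ^ p * t ^ (n / β) * (c * κ ^ n * M₁ ^ p)
        = 2 ^ p * (M₁ ^ p * t ^ p / 2 ^ p * (c * (κ ^ n * t ^ (n / β)))) := by
          field_simp
      _ ≤ 2 ^ p * M₀ ^ p := by gcongr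
  have hfinal := le_rpow_mul_rpow_of_rpow_le ht0 ht1 (div_pos hM₀ hM₁) hK hp0 hθ2
    (add_div_mul_one_sub_le n.cast_nonneg hp0 hβ0 hθ1) hkey
  have hsplit : M₁ * (M₀ / M₁) ^ (1 - θ) = M₀ ^ (1 - θ) * M₁ ^ θ := by
    rw [Real.div_rpow hM₀.le hM₁.le, Real.rpow_sub hM₁, Real.rpow_one]
    field_simp
  rw [hfxt, mul_assoc, ← hsplit, mul_left_comm]
  gcongr
end
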